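/- For all integers n ≥ 2 and all integers k with 1 ≤ k ≤ n−1, the elementary symmetric functions of the eigenvalues of the matrices A_n and A_{n−1} satisfy S_k^n = S_k^{n−1} + Σ_{i=1}^{n−k+1} S_{k−1}^{n−i}. -/

import Mathlib

/-- The `m × m` matrix with entries `min(i, j)` (1-indexed). -/
def Amat (m : ℕ) : Matrix (Fin m) (Fin m) ℤ :=
  Matrix.of fun i j => (min (i.val + 1) (j.val + 1) : ℤ)

/-- `S k m` is the sum of the determinants of all `k × k` principal submatrices of `Amat m`
(for `k = 0` this is `1`, the determinant of the empty matrix). -/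
def S (k m : ℕ) : ℤ :=
  ∑ T ∈ Finset.powersetCard k (Finset.univ : Finset (Fin m)),
    ((Amat m).submatrix (fun a : {x // x ∈ T} => (a : Fin m))
      (fun a : {x // x ∈ T} => (a : Fin m))).det

/-- The `m × m` matrix with entries `min(i, j) + c` (1-indexed). -/
def shiftedMinMatrix (m : ℕ) (c : ℤ) : Matrix (Fin m) (Fin m) ℤ :=
  Matrix.of fun i j => (min (i.val + 1) (j.val + 1) : ℤ) + c

/-- The sum of the determinants of the `k × k` principal submatrices of `A`. -/
def sumPrincipalMinors {R : Type*} [CommRing R] {m : ℕ} (A : Matrix (Fin m) (Fin m) R) (k : ℕ) :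
    R :=
  ∑ T ∈ Finset.powersetCard k (Finset.univ : Finset (Fin m)),
    (A.submatrix (fun a : {x // x ∈ T} => (a : Fin m)) (fun a : {x // x ∈ T} => (a : Fin m))).det

lemma S_eq_sumPrincipalMinors (k m : ℕ) :
    S k m = sumPrincipalMinors (shiftedMinMatrix m 0) k := by
  have h : shiftedMinMatrix m 0 = Amat m := by
    ext i j
    simp [shiftedMinMatrix, Amat]
  rw [h]
  rfl

lemma Fin.sum_powersetCard_succ_univ_succ {M : Type*} [AddCommMonoid M] (m k : ℕ)
    (f : Finset (Fin (m + 1)) → M) :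
    ∑ T ∈ Finset.powersetCard (k + 1) Finset.univ, f T =
      ∑ T ∈ Finset.powersetCard (k + 1) (Finset.univ : Finset (Fin m)),
          f (T.map (Fin.succEmb m)) +
        ∑ T ∈ Finset.powersetCard k (Finset.univ : Finset (Fin m)),
          f (insert 0 (T.map (Fin.succEmb m))) := by
  have h0 (T : Finset (Fin m)) : (0 : Fin (m + 1)) ∉ T.map (Fin.succEmb m) := by
    simp [Fin.succ_ne_zero]
  have huniv : (Finset.univ : Finset (Fin (m + 1))) =
      insert 0 (Finset.univ.map (Fin.succEmb m)) := by
    rw [Fin.univ_succ, Finset.cons_eq_insert]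
    rfl
  rw [huniv, Finset.powersetCard_succ_insert (h0 _), Finset.sum_union, Finset.powersetCard_map,
    Finset.powersetCard_map, Finset.sum_map, Finset.sum_image, Finset.sum_map]
  · rfl
  · intro s hs t ht hst
    simp only [Finset.coe_map, Set.mem_image] at hs ht
    obtain ⟨s, -, rfl⟩ := hs
    obtain ⟨t, -, rfl⟩ := ht
    have h := congrArg (Finset.erase · 0) hst
    exact (Finset.erase_insert (h0 s)).symm.trans (h.trans (Finset.erase_insert (h0 t)))
  · refine Finset.disjoint_left.2 fun s hs hs' => ?_
    obtain ⟨t, -, rfl⟩ := Finset.mem_image.1 hs'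
    exact h0 _ ((Finset.mem_powersetCard.1 hs).1 (Finset.mem_insert_self 0 t))

lemma Matrix.det_submatrix_map_finset {R α β : Type*} [CommRing R] [DecidableEq α]
    [DecidableEq β] (A : Matrix β β R) (f : α ↪ β) (T : Finset α) :
    (A.submatrix (fun a : {x // x ∈ T.map f} => (a : β))
      (fun a : {x // x ∈ T.map f} => (a : β))).det =
    ((A.submatrix f f).submatrix (fun a : {x // x ∈ T} => (a : α))
      (fun a : {x // x ∈ T} => (a : α))).det := by
  let g : {x // x ∈ T} → {x // x ∈ T.map f} :=
    fun t => ⟨f t, Finset.mem_map_of_mem f t.2⟩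
  have hg : Function.Bijective g := by
    refine ⟨fun a b h => Subtype.ext (f.injective (congrArg Subtype.val h)), ?_⟩
    rintro ⟨x, hx⟩
    obtain ⟨t, ht, rfl⟩ := Finset.mem_map.1 hx
    exact ⟨⟨t, ht⟩, rfl⟩
  rw [← Matrix.det_submatrix_equiv_self (Equiv.ofBijective g hg)]
  rfl

lemma Matrix.det_fromBlocks_add_const {R ι : Type*} [CommRing R] [Fintype ι] [DecidableEq ι]
    (r : R) (D : Matrix ι ι R) :
    (Matrix.fromBlocks (Matrix.of fun _ _ : Unit => r) (Matrix.of fun _ _ => r)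
      (Matrix.of fun _ _ => r) (Matrix.of fun i j => D i j + r)).det = r * D.det := by
  have h : Matrix.fromBlocks (Matrix.of fun _ _ : Unit => r) (Matrix.of fun _ _ => r)
      (Matrix.of fun _ _ => r) (Matrix.of fun i j => D i j + r) =
      Matrix.fromBlocks 1 0 (Matrix.of fun _ _ => 1) 1 *
        Matrix.fromBlocks (Matrix.of fun _ _ : Unit => r) (Matrix.of fun _ _ => r) 0 D := by
    rw [Matrix.fromBlocks_multiply]
    congr 1 <;> ext i j <;> simp [Matrix.mul_apply, add_comm]
  rw [h, Matrix.det_mul, Matrix.det_fromBlocks_zero₁₂, Matrix.det_fromBlocks_zero₂₁]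
  simp

lemma shiftedMinMatrix_submatrix_succ (m : ℕ) (c : ℤ) :
    (shiftedMinMatrix (m + 1) c).submatrix (Fin.succEmb m) (Fin.succEmb m) =
      shiftedMinMatrix m (c + 1) := by
  ext i j
  simp only [shiftedMinMatrix, Matrix.submatrix_apply, Matrix.of_apply, Fin.coe_succEmb,
    Fin.val_succ]
  push_cast
  omega

lemma det_shiftedMinMatrix_insert_zero (m : ℕ) (c : ℤ) (T : Finset (Fin m)) :
    ((shiftedMinMatrix (m + 1) c).submatrix
      (fun a : {x // x ∈ insert 0 (T.map (Fin.succEmb m))} => (a : Fin (m + 1)))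
      (fun a : {x // x ∈ insert 0 (T.map (Fin.succEmb m))} => (a : Fin (m + 1)))).det =
    (c + 1) * ((shiftedMinMatrix m 0).submatrix (fun a : {x // x ∈ T} => (a : Fin m))
      (fun a : {x // x ∈ T} => (a : Fin m))).det := by
  let g : Unit ⊕ {x // x ∈ T} → {x // x ∈ insert 0 (T.map (Fin.succEmb m))} :=
    Sum.elim (fun _ => ⟨0, by simp⟩) (fun t => ⟨t.1.succ, by simp⟩)
  have hg : Function.Bijective g := by
    constructor
    · rintro (_ | a) (_ | b) h
      · rfl
      · exact absurd (congrArg Subtype.val h).symm (Fin.succ_ne_zero _)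
      · exact absurd (congrArg Subtype.val h) (Fin.succ_ne_zero _)
      · exact congrArg Sum.inr (Subtype.ext (Fin.succ_injective _ (congrArg Subtype.val h)))
    · rintro ⟨x, hx⟩
      rcases Finset.mem_insert.1 hx with rfl | hx'
      · exact ⟨Sum.inl (), rfl⟩
      · obtain ⟨t, ht, rfl⟩ := Finset.mem_map.1 hx'
        exact ⟨Sum.inr ⟨t, ht⟩, rfl⟩
  rw [← Matrix.det_submatrix_equiv_self (Equiv.ofBijective g hg),
    ← Matrix.det_fromBlocks_add_const]
  congr 1
  ext (i | i) (j | j) <;> simp [g, shiftedMinMatrix] <;> omega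

lemma sumPrincipalMinors_shiftedMinMatrix_succ (m k : ℕ) (c : ℤ) :
    sumPrincipalMinors (shiftedMinMatrix (m + 1) c) (k + 1) =
      sumPrincipalMinors (shiftedMinMatrix m (c + 1)) (k + 1) +
        (c + 1) * sumPrincipalMinors (shiftedMinMatrix m 0) k := by
  unfold sumPrincipalMinors
  rw [Fin.sum_powersetCard_succ_univ_succ, Finset.mul_sum]
  simp_rw [Matrix.det_submatrix_map_finset, shiftedMinMatrix_submatrix_succ,
    det_shiftedMinMatrix_insert_zero]

lemma sumPrincipalMinors_zero {R : Type*} [CommRing R] {m : ℕ} (A : Matrix (Fin m) (Fin m) R) :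
    sumPrincipalMinors A 0 = 1 := by
  simp [sumPrincipalMinors]

lemma sumPrincipalMinors_shiftedMinMatrix (m k : ℕ) (c : ℤ) :
    sumPrincipalMinors (shiftedMinMatrix m c) (k + 1) =
      (m + k + 1).choose (2 * k + 2) + c * (m + k).choose (2 * k + 1) := by
  induction m generalizing k c with
  | zero =>
    rw [Nat.choose_eq_zero_of_lt (by omega), Nat.choose_eq_zero_of_lt (by omega)]
    simp [sumPrincipalMinors]
  | succ m ih =>
    have hk : sumPrincipalMinors (shiftedMinMatrix m 0) k = (m + k).choose (2 * k) := by
      cases k with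
      | zero => simp [sumPrincipalMinors_zero]
      | succ k => rw [ih, zero_mul, add_zero]; rfl
    rw [sumPrincipalMinors_shiftedMinMatrix_succ, ih, hk, show m + 1 + k = m + k + 1 by ring,
      Nat.choose_succ_succ (m + k + 1) (2 * k + 1), Nat.choose_succ_succ (m + k) (2 * k)]
    push_cast
    ring

lemma S_eq_choose (k m : ℕ) : S k m = (m + k).choose (2 * k) := by
  rw [S_eq_sumPrincipalMinors]
  cases k with
  | zero => simp [sumPrincipalMinors_zero]
  | succ k => rw [sumPrincipalMinors_shiftedMinMatrix, zero_mul, add_zero]; rfl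

/-- For `n ≥ 2` and `1 ≤ k ≤ n - 1`, the elementary symmetric functions of the eigenvalues
of `A_n` and `A_{n-1}` satisfy `S_k^n = S_k^{n-1} + Σ_{i=1}^{n-k+1} S_{k-1}^{n-i}`. -/
theorem S_recurrence' (n k : ℕ) (hn : 2 ≤ n) (hk1 : 1 ≤ k) (hkn : k ≤ n - 1) :
    S k n = S k (n - 1) + ∑ i ∈ Finset.Icc 1 (n - k + 1), S (k - 1) (n - i) := by
  obtain ⟨k, rfl⟩ := Nat.exists_eq_add_of_le' hk1
  obtain ⟨d, rfl⟩ := Nat.exists_eq_add_of_le (hkn.trans (Nat.sub_le n 1))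
  have hsum : ∑ i ∈ Finset.Icc 1 (d + 1), (k + 1 + d - i + k).choose (2 * k) =
      (2 * k + d + 1).choose (2 * k + 1) := by
    rw [← Nat.sum_Icc_choose]
    refine Finset.sum_nbij' (fun i => 2 * k + 1 + d - i) (fun i => 2 * k + 1 + d - i) ?_ ?_ ?_ ?_ ?_
      <;> intro i hi <;> rw [Finset.mem_Icc] at hi
    · rw [Finset.mem_Icc]; omega
    · rw [Finset.mem_Icc]; omega
    · omega
    · omega
    · congr 1; omega
  simp only [S_eq_choose, Nat.add_sub_cancel, Nat.add_sub_cancel_left]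
  rw [← Nat.cast_sum, hsum, show k + 1 + d + (k + 1) = 2 * k + d + 1 + 1 by ring,
    show k + 1 + d - 1 + (k + 1) = 2 * k + d + 1 by omega, show 2 * (k + 1) = 2 * k + 1 + 1 by ring,
    Nat.choose_succ_succ]
  push_cast
  ring
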